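/- Let (i,j) be an index pair with j ≥ n and i + j < 2n (so 1 ≤ i ≤ j). Let (V_{k,l}) be a point of SpR_{2n} lying in Z_{i,j}, i.e. V_{i,j} = V_{i−1,j+1} + ℂw_{j+1}. Then there exists a point (V′_{k,l}) of SpR_{2n}, distinct from (V_{k,l}), which also lies in Z_{i,j} and has the same diagonal entries: V′_{k,k} = V_{k,k} for all 1 ≤ k ≤ n. (This is the key step showing that the divisor Z_{i,j} is exceptional for the resolution SpR_{2n} → Sp𝓕ᵃ_{2n} exactly when j ≥ n and i + j < 2n.) -/

import Mathlib

noncomputable section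

/-- The ambient 2n-dimensional complex vector space `W = ℂ^{2n}`. -/
abbrev Wsp (n : ℕ) := Fin (2*n) → ℂ

/-- The basis vector `w_k` (1-based index `k ∈ {1,…,2n}`). -/
def wvec (n k : ℕ) : Wsp n := fun i => if (i : ℕ) + 1 = k then 1 else 0

/-- The standard symplectic form: `⟨w_i, w_{2n+1-i}⟩ = 1` for `1 ≤ i ≤ n`,
and `⟨w_i, w_j⟩ = 0` for `j ≠ 2n+1-i`. -/
def sform (n : ℕ) (x y : Wsp n) : ℂ :=
  ∑ i : Fin (2*n), (if (i : ℕ) < n then 1 else -1) * x i *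
    y ⟨2*n - 1 - (i : ℕ), by have := i.isLt; omega⟩

/-- A subspace is isotropic if the symplectic form vanishes on it. -/
def IsIsotropic (n : ℕ) (U : Submodule ℂ (Wsp n)) : Prop :=
  ∀ u ∈ U, ∀ v ∈ U, sform n u v = 0

/-- The projection `pr_k` along `w_k` (1-based). -/
def prj (n k : ℕ) : Wsp n →ₗ[ℂ] Wsp n where
  toFun x := fun i => if (i : ℕ) + 1 = k then 0 else x i
  map_add' x y := by funext i; by_cases h : (i : ℕ) + 1 = k <;> simp [h]
  map_smul' c x := by funext i; by_cases h : (i : ℕ) + 1 = k <;> simp [h]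

/-- The subspace `W_{i,j} = span(w_1,…,w_i,w_{j+1},…,w_{2n})` (1-based). -/
def WIJ (n i j : ℕ) : Submodule ℂ (Wsp n) :=
  Submodule.span ℂ (wvec n '' {k | (1 ≤ k ∧ k ≤ i) ∨ (j + 1 ≤ k ∧ k ≤ 2*n)})

/-- Orthogonal complement with respect to the symplectic form. -/
def sperp (n : ℕ) (U : Submodule ℂ (Wsp n)) : Submodule ℂ (Wsp n) where
  carrier := {x | ∀ u ∈ U, sform n x u = 0}
  zero_mem' := by intro u hu; simp [sform]
  add_mem' := by
    intro a b ha hb u hu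
    have ha' := ha u hu
    have hb' := hb u hu
    simp only [sform, Pi.add_apply, add_mul, mul_add, Finset.sum_add_distrib] at *
    rw [ha', hb', add_zero]
  smul_mem' := by
    intro c a ha u hu
    have ha' := ha u hu
    simp only [sform, Pi.smul_apply, smul_eq_mul] at *
    calc ∑ i : Fin (2*n), (if (i : ℕ) < n then 1 else -1) * (c * a i) *
          u ⟨2*n - 1 - (i : ℕ), by have := i.isLt; omega⟩
        = c * ∑ i : Fin (2*n), (if (i : ℕ) < n then 1 else -1) * a i *
          u ⟨2*n - 1 - (i : ℕ), by have := i.isLt; omega⟩ := by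
          rw [Finset.mul_sum]; congr 1; funext i; ring
      _ = 0 := by rw [ha', mul_zero]

/-- The points of the Bott–Samelson type resolution `SpR_{2n}`:
collections `(V_{i,j})` for `1 ≤ i ≤ j`, `i+j ≤ 2n`. -/
structure IsSpR (n : ℕ) (V : ℕ → ℕ → Submodule ℂ (Wsp n)) : Prop where
  dim : ∀ i j, 1 ≤ i → i ≤ j → i + j ≤ 2*n → Module.finrank ℂ (V i j) = i
  sub : ∀ i j, 1 ≤ i → i ≤ j → i + j ≤ 2*n → V i j ≤ WIJ n i j
  mono : ∀ i j, 1 ≤ i → i + 1 ≤ j → (i + 1) + j ≤ 2*n → V i j ≤ V (i+1) j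
  proj : ∀ i j, 1 ≤ i → i ≤ j → i + (j+1) ≤ 2*n →
    Submodule.map (prj n (j+1)) (V i j) ≤ V i (j+1)
  isot : ∀ i, 1 ≤ i → i ≤ n → IsIsotropic n (V i (2*n - i))

/-- A point of `SpR_{2n}` lies in the divisor `Z_{i,j}` if
`V_{i,j} = V_{i-1,j+1} + ℂ w_{j+1}` (with `V_0 = 0`). -/
def InZ (n : ℕ) (V : ℕ → ℕ → Submodule ℂ (Wsp n)) (i j : ℕ) : Prop :=
  V i j = (if i = 1 then ⊥ else V (i-1) (j+1)) ⊔ Submodule.span ℂ {wvec n (j+1)}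

section LinearAlgebra

variable {K E F : Type*} [Field K] [AddCommGroup E] [Module K E] [FiniteDimensional K E]
  [AddCommGroup F] [Module K F]

open Module

theorem finrank_map_add_finrank_inf_ker (f : E →ₗ[K] F) (X : Submodule K E) :
    finrank K (X.map f) + finrank K (X ⊓ LinearMap.ker f : Submodule K E) = finrank K X := by
  have h := LinearMap.finrank_range_add_finrank_ker (f.domRestrict X)
  rw [LinearMap.range_domRestrict, LinearMap.ker_domRestrict] at h
  rw [← h, ← Submodule.map_comap_subtype, Submodule.finrank_map_subtype_eq]

theorem finrank_le_finrank_inf_ker_add [FiniteDimensional K F] (f : E →ₗ[K] F)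
    (X : Submodule K E) :
    finrank K X ≤ finrank K (X ⊓ LinearMap.ker f : Submodule K E) + finrank K F := by
  have h := finrank_map_add_finrank_inf_ker f X
  have := Submodule.finrank_le (X.map f)
  omega

/-- A subspace grows in dimension by exactly one when a vector outside it is adjoined. -/
theorem finrank_sup_span_singleton_of_notMem {A : Submodule K E} {v : E} (hv : v ∉ A) :
    finrank K (A ⊔ Submodule.span K {v} : Submodule K E) = finrank K A + 1 := by
  have hv0 : v ≠ 0 := fun h => hv (h ▸ A.zero_mem)
  have h := Submodule.finrank_sup_add_finrank_inf_eq A (Submodule.span K {v})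
  have hd : A ⊓ Submodule.span K {v} = ⊥ :=
    disjoint_iff.mp ((Submodule.disjoint_span_singleton' hv0).mpr hv)
  rw [hd, finrank_bot, finrank_span_singleton hv0] at h
  omega

theorem exists_finrank_eq_of_le_of_le {A B : Submodule K E} (hAB : A ≤ B) (d : ℕ)
    (hA : finrank K A ≤ d) (hB : d ≤ finrank K B) :
    ∃ X, A ≤ X ∧ X ≤ B ∧ finrank K X = d := by
  induction d with
  | zero => exact ⟨A, le_rfl, hAB, by omega⟩
  | succ d ih =>
    rcases hA.lt_or_eq with h | h
    · obtain ⟨X, hAX, hXB, hX⟩ := ih (by omega) (by omega)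
      have hne : ¬ B ≤ X := fun hBX => by
        have := Submodule.finrank_mono hBX
        omega
      obtain ⟨v, hvB, hvX⟩ := SetLike.not_le_iff_exists.mp hne
      refine ⟨X ⊔ Submodule.span K {v}, hAX.trans le_sup_left, sup_le hXB ?_, ?_⟩
      · rwa [Submodule.span_singleton_le_iff_mem]
      · rw [finrank_sup_span_singleton_of_notMem hvX, hX]
    · exact ⟨A, le_rfl, hAB, h⟩

theorem finrank_map_sup_le (f : E →ₗ[K] E) {A B A' : Submodule K E} (hAB : A ≤ B)
    (hA : A.map f ≤ A') (h : finrank K A' ≤ finrank K A) :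
    finrank K (B.map f ⊔ A' : Submodule K E) ≤ finrank K B := by
  obtain ⟨T, hT, rfl⟩ := IsModularLattice.exists_disjoint_and_sup_eq hAB
  have h1 : (A ⊔ T).map f ⊔ A' = T.map f ⊔ A' := by
    rw [Submodule.map_sup]
    apply le_antisymm
    · exact sup_le (sup_le (hA.trans le_sup_right) le_sup_left) le_sup_right
    · exact sup_le (le_sup_right.trans le_sup_left) le_sup_right
  have h2 := Submodule.finrank_sup_add_finrank_inf_eq A T
  rw [disjoint_iff.mp hT, finrank_bot] at h2
  have h3 := Submodule.finrank_add_le_finrank_add_finrank (T.map f) A'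
  have h4 := Submodule.finrank_map_le f T
  rw [h1]
  omega

/-- A flag interpolating between lower bounds `G k` and upper bounds `Q k`, with prescribed top
member `L`, exists as soon as each `Q k` has codimension at most one in `Q (k + 1)`. -/
theorem exists_flag (G Q : ℕ → Submodule K E) (i m : ℕ) (him : i ≤ m)
    (hGQ : ∀ k, i ≤ k → k < m → G k ≤ Q k)
    (hG : ∀ k, i ≤ k → k < m → finrank K (G k) ≤ k)
    (hGmono : ∀ k, i ≤ k → k < m → G k ≤ G (k + 1))
    (hQ : ∀ k, i ≤ k → k < m → ∀ X ≤ Q (k + 1),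
      finrank K X ≤ finrank K (X ⊓ Q k : Submodule K E) + 1)
    (L : Submodule K E) (hGL : G m ≤ L) (hLQ : L ≤ Q m) (hL : finrank K L = m) :
    ∃ C : ℕ → Submodule K E, C m = L ∧
      (∀ k, i ≤ k → k ≤ m → G k ≤ C k ∧ C k ≤ Q k ∧ finrank K (C k) = k) ∧
      ∀ k, i ≤ k → k < m → C k ≤ C (k + 1) := by
  induction m, him using Nat.le_induction generalizing L with
  | base =>
    refine ⟨fun _ => L, rfl, fun k h1 h2 => ?_, fun k h1 h2 => le_rfl⟩
    obtain rfl : k = i := by omega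
    exact ⟨hGL, hLQ, hL⟩
  | succ m him ih =>
    have hcod := hQ m him (by omega) L hLQ
    obtain ⟨L', h1, h2, h3⟩ := exists_finrank_eq_of_le_of_le
      (le_inf ((hGmono m him (by omega)).trans hGL) (hGQ m him (by omega))) m
      (hG m him (by omega)) (by omega)
    obtain ⟨C, hCm, hC, hCmono⟩ := ih (fun k h h' => hGQ k h (by omega))
      (fun k h h' => hG k h (by omega)) (fun k h h' => hGmono k h (by omega))
      (fun k h h' => hQ k h (by omega)) L' h1 (h2.trans inf_le_right) h3
    refine ⟨fun k => if k = m + 1 then L else C k, if_pos rfl, fun k hk hk' => ?_,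
      fun k hk hk' => ?_⟩
    · by_cases h : k = m + 1
      · subst h
        beta_reduce
        rw [if_pos rfl]
        exact ⟨hGL, hLQ, hL⟩
      · beta_reduce
        rw [if_neg h]
        exact hC k hk (by omega)
    · have hne : k ≠ m + 1 := by omega
      rcases eq_or_ne k m with rfl | h
      · simpa [hCm] using h2.trans inf_le_left
      · simpa [h, hne] using hCmono k hk (by omega)

end LinearAlgebra

theorem exists_seq_of_step {α : Type*} {P : ℕ → α → Prop} {r : ℕ → α → α → Prop} (a : α)
    (h0 : P 0 a) (step : ∀ l a, P l a → ∃ b, P (l + 1) b ∧ r l a b) :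
    ∃ s : ℕ → α, s 0 = a ∧ ∀ l, P l (s l) ∧ r l (s l) (s (l + 1)) := by
  choose f hf hr using step
  let g : ∀ l, {a // P l a} := fun l => Nat.rec ⟨a, h0⟩ (fun l b => ⟨f l b.1 b.2, hf l b.1 b.2⟩) l
  exact ⟨fun l => (g l).1, rfl, fun l => ⟨(g l).2, hr l _ (g l).2⟩⟩

section SymplecticForm

open Module

variable {n : ℕ}

theorem mem_WIJ {i j : ℕ} {x : Wsp n} :
    x ∈ WIJ n i j ↔ ∀ t : Fin (2 * n), i ≤ t → (t : ℕ) < j → x t = 0 := by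
  constructor
  · intro hx t h1 h2
    have hle : WIJ n i j ≤ LinearMap.ker (LinearMap.proj (R := ℂ) (φ := fun _ => ℂ) t) := by
      refine Submodule.span_le.mpr ?_
      rintro _ ⟨k, hk, rfl⟩
      have : (t : ℕ) + 1 ≠ k := by
        rcases hk with hk | hk <;> omega
      simp [wvec, this]
    exact hle hx
  · intro h
    have hx : x = ∑ t : Fin (2 * n), x t • wvec n (t + 1) := by
      funext s
      simp [wvec, Finset.sum_apply, ← Fin.ext_iff]
    rw [hx]
    refine Submodule.sum_mem _ fun t _ => ?_
    by_cases ht : i ≤ (t : ℕ) ∧ (t : ℕ) < j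
    · simp [h t ht.1 ht.2]
    · refine Submodule.smul_mem _ _ (Submodule.subset_span ⟨t + 1, ?_, rfl⟩)
      have := t.isLt
      simp only [Set.mem_ofPred_eq]
      omega

theorem WIJ_mono {i i' j j' : ℕ} (hi : i ≤ i') (hj : j' ≤ j) : WIJ n i j ≤ WIJ n i' j' :=
  fun _ hx => mem_WIJ.mpr fun t h1 h2 => mem_WIJ.mp hx t (hi.trans h1) (h2.trans_le hj)

theorem finrank_WIJ (i j : ℕ) (hij : i ≤ j) (hj : j ≤ 2 * n) :
    2 * n ≤ finrank ℂ (WIJ n i j) + (j - i) := by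
  let f : Wsp n →ₗ[ℂ] (Fin (j - i) → ℂ) :=
    LinearMap.funLeft ℂ ℂ (fun s => ⟨i + s, by omega⟩)
  have h := finrank_le_finrank_inf_ker_add f ⊤
  have hle : LinearMap.ker f ≤ WIJ n i j := by
    intro x hx
    refine mem_WIJ.mpr fun t h1 h2 => ?_
    have := congrFun (LinearMap.mem_ker.mp hx) ⟨t - i, by omega⟩
    simpa [f, LinearMap.funLeft_apply, Nat.add_sub_cancel' h1] using this
  have := Submodule.finrank_mono hle
  rw [top_inf_eq, finrank_top, finrank_fin_fun, finrank_fin_fun] at h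
  omega

@[simp]
theorem prj_apply (k : ℕ) (x : Wsp n) (t : Fin (2 * n)) :
    prj n k x t = if (t : ℕ) + 1 = k then 0 else x t := rfl

theorem prj_eq_self {i j k : ℕ} {x : Wsp n} (hx : x ∈ WIJ n i j) (hi : i < k) (hj : k ≤ j) :
    prj n k x = x := by
  funext t
  rw [prj_apply]
  split_ifs with h
  · exact (mem_WIJ.mp hx t (by omega) (by omega)).symm
  · rfl

theorem prj_mem_WIJ {i j : ℕ} {x : Wsp n} (hx : x ∈ WIJ n i j) :
    prj n (j + 1) x ∈ WIJ n i (j + 1) := by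
  refine mem_WIJ.mpr fun t h1 h2 => ?_
  rw [prj_apply]
  split_ifs with h
  · rfl
  · exact mem_WIJ.mp hx t h1 (by omega)

theorem ker_prj_le (k : ℕ) : LinearMap.ker (prj n k) ≤ Submodule.span ℂ {wvec n k} := by
  intro x hx
  rw [Submodule.mem_span_singleton]
  by_cases hk : 1 ≤ k ∧ k ≤ 2 * n
  · refine ⟨x ⟨k - 1, by omega⟩, ?_⟩
    funext t
    have h := congrFun (LinearMap.mem_ker.mp hx) t
    rw [prj_apply] at h
    by_cases ht : (t : ℕ) + 1 = k
    · subst ht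
      simp [wvec]
    · rw [if_neg ht] at h
      simp [wvec, ht, h]
  · refine ⟨0, ?_⟩
    funext t
    have h := congrFun (LinearMap.mem_ker.mp hx) t
    have := t.isLt
    rw [prj_apply, if_neg (by omega)] at h
    simp [h]

theorem prj_wvec (k : ℕ) : prj n k (wvec n k) = 0 := by
  funext t
  simp only [prj_apply, wvec, Pi.zero_apply]
  split_ifs <;> rfl

theorem finrank_ker_prj_le (k : ℕ) : finrank ℂ (LinearMap.ker (prj n k)) ≤ 1 :=
  (Submodule.finrank_mono (ker_prj_le k)).trans ((finrank_span_le_card _).trans (by simp))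

/-- The symplectic form as a bilinear map. -/
def sformB (n : ℕ) : Wsp n →ₗ[ℂ] Wsp n →ₗ[ℂ] ℂ :=
  LinearMap.mk₂ ℂ (sform n)
    (fun x x' y => by
      simp only [sform, Pi.add_apply, mul_add, add_mul, Finset.sum_add_distrib])
    (fun c x y => by
      simp only [sform, Pi.smul_apply, smul_eq_mul, Finset.mul_sum]
      exact Finset.sum_congr rfl fun _ _ => by ring)
    (fun x y y' => by
      simp only [sform, Pi.add_apply, mul_add, Finset.sum_add_distrib])
    (fun c x y => by
      simp only [sform, Pi.smul_apply, smul_eq_mul, Finset.mul_sum]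
      exact Finset.sum_congr rfl fun _ _ => by ring)

theorem sform_swap (x y : Wsp n) : sform n x y = - sform n y x := by
  unfold sform
  rw [← Finset.sum_neg_distrib, ← Equiv.sum_comp Fin.revPerm]
  refine Finset.sum_congr rfl fun t _ => ?_
  have ht := t.isLt
  have h1 : Fin.revPerm t = ⟨2 * n - 1 - t, by omega⟩ :=
    Fin.ext (by simp only [Fin.revPerm_apply, Fin.val_rev]; omega)
  have h2 : (⟨2 * n - 1 - (2 * n - 1 - t), by omega⟩ : Fin (2 * n)) = t :=
    Fin.ext (by simp only []; omega)
  simp only [h1, h2]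
  by_cases h : (t : ℕ) < n
  · rw [if_pos h, if_neg (by omega)]
    ring
  · rw [if_neg h, if_pos (by omega)]
    ring

theorem sform_self (x : Wsp n) : sform n x x = 0 :=
  self_eq_neg.mp (sform_swap x x)

theorem sform_eq_zero_comm {x y : Wsp n} : sform n x y = 0 ↔ sform n y x = 0 := by
  rw [sform_swap, neg_eq_zero]

theorem sform_add_right (x y y' : Wsp n) : sform n x (y + y') = sform n x y + sform n x y' :=
  map_add (sformB n x) y y'

theorem sform_smul_right (c : ℂ) (x y : Wsp n) : sform n x (c • y) = c * sform n x y :=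
  map_smul (sformB n x) c y

theorem sform_smul_left (c : ℂ) (x y : Wsp n) : sform n (c • x) y = c * sform n x y :=
  LinearMap.map_smul₂ (sformB n) c x y

theorem le_sperp_comm {U U' : Submodule ℂ (Wsp n)} : U ≤ sperp n U' ↔ U' ≤ sperp n U :=
  ⟨fun h x hx _ hy => sform_eq_zero_comm.mp (h hy x hx),
    fun h x hx _ hy => sform_eq_zero_comm.mp (h hy x hx)⟩

theorem sperp_anti {U U' : Submodule ℂ (Wsp n)} (h : U ≤ U') : sperp n U' ≤ sperp n U :=
  fun _ hx u hu => hx u (h hu)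

theorem isIsotropic_iff_le_sperp {U : Submodule ℂ (Wsp n)} : IsIsotropic n U ↔ U ≤ sperp n U :=
  Iff.rfl

theorem IsIsotropic.mono {U U' : Submodule ℂ (Wsp n)} (h : IsIsotropic n U') (hU : U ≤ U') :
    IsIsotropic n U :=
  fun x hx y hy => h x (hU hx) y (hU hy)

theorem IsIsotropic.sup {U U' : Submodule ℂ (Wsp n)} (h : IsIsotropic n U)
    (h' : IsIsotropic n U') (hUU' : U ≤ sperp n U') : IsIsotropic n (U ⊔ U') := by
  rw [isIsotropic_iff_le_sperp]
  refine sup_le (le_sperp_comm.mp (sup_le h ?_)) (le_sperp_comm.mp (sup_le hUU' h'))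
  exact le_sperp_comm.mp hUU'

theorem isIsotropic_span_singleton (v : Wsp n) : IsIsotropic n (Submodule.span ℂ {v}) := by
  intro x hx y hy
  obtain ⟨a, rfl⟩ := Submodule.mem_span_singleton.mp hx
  obtain ⟨b, rfl⟩ := Submodule.mem_span_singleton.mp hy
  rw [sform_smul_left, sform_smul_right, sform_self, mul_zero, mul_zero]

theorem finrank_le_finrank_inf_sperp_add (X U : Submodule ℂ (Wsp n)) :
    finrank ℂ X ≤ finrank ℂ (X ⊓ sperp n U : Submodule ℂ (Wsp n)) + finrank ℂ U := by
  let f : Wsp n →ₗ[ℂ] Module.Dual ℂ U := (Submodule.subtype U).dualMap ∘ₗ sformB n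
  have h := finrank_le_finrank_inf_ker_add f X
  rw [Subspace.dual_finrank_eq] at h
  have hle : LinearMap.ker f ≤ sperp n U := fun x hx u hu =>
    LinearMap.congr_fun (LinearMap.mem_ker.mp hx) ⟨u, hu⟩
  have := Submodule.finrank_mono (inf_le_inf_left X hle)
  omega

theorem sform_eq_sform_of_mul_eq {x y x' y' : Wsp n}
    (h : ∀ s t : Fin (2 * n), (s : ℕ) + t + 1 = 2 * n → x s * y t = x' s * y' t) :
    sform n x y = sform n x' y' := by
  refine Finset.sum_congr rfl fun t _ => ?_
  rw [mul_assoc, mul_assoc, h t _ (by have := t.isLt; simp only []; omega)]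

theorem IsIsotropic.map_prj {i j : ℕ} {U : Submodule ℂ (Wsp n)} (hU : IsIsotropic n U)
    (hUW : U ≤ WIJ n i j) (hn : n ≤ j) (hij : i + j < 2 * n) :
    IsIsotropic n (U.map (prj n (j + 1))) := by
  rintro _ ⟨x, hx, rfl⟩ _ ⟨y, hy, rfl⟩
  rw [← hU x hx y hy]
  refine sform_eq_sform_of_mul_eq fun s t hst => ?_
  rw [prj_apply, prj_apply]
  by_cases hs : (s : ℕ) + 1 = j + 1
  · rw [mem_WIJ.mp (hUW hy) t (by omega) (by omega)]
    simp
  · by_cases ht : (t : ℕ) + 1 = j + 1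
    · rw [mem_WIJ.mp (hUW hx) s (by omega) (by omega)]
      simp
    · rw [if_neg hs, if_neg ht]

/-- An isotropic subspace of `W_{m,2n-m}` of dimension at most `m` extends to one of
dimension `m`. -/
theorem exists_lagrangian {m : ℕ} (hm : m ≤ n) (d : ℕ) {G : Submodule ℂ (Wsp n)}
    (hG : IsIsotropic n G) (hGW : G ≤ WIJ n m (2 * n - m)) (hd : finrank ℂ G + d = m) :
    ∃ L, G ≤ L ∧ IsIsotropic n L ∧ L ≤ WIJ n m (2 * n - m) ∧ finrank ℂ L = m := by
  induction d generalizing G with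
  | zero => exact ⟨G, le_rfl, hG, hGW, hd⟩
  | succ d ih =>
    have h1 := finrank_WIJ (n := n) m (2 * n - m) (by omega) (by omega)
    have h2 := finrank_le_finrank_inf_sperp_add (WIJ n m (2 * n - m)) G
    have hne : ¬ (WIJ n m (2 * n - m) ⊓ sperp n G ≤ G) := fun hle => by
      have := Submodule.finrank_mono hle
      omega
    obtain ⟨v, ⟨hvW, hvG⟩, hv⟩ := SetLike.not_le_iff_exists.mp hne
    obtain ⟨L, hL, h⟩ := ih (G := G ⊔ Submodule.span ℂ {v})
      (hG.sup (isIsotropic_span_singleton v) (le_sperp_comm.mp (by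
        rwa [Submodule.span_singleton_le_iff_mem])))
      (sup_le hGW (by rwa [Submodule.span_singleton_le_iff_mem]))
      (by rw [finrank_sup_span_singleton_of_notMem hv]; omega)
    exact ⟨L, le_sup_left.trans hL, h⟩

theorem exists_lagrangian_ne {m : ℕ} (hm : m ≤ n) {G : Submodule ℂ (Wsp n)}
    (hG : IsIsotropic n G) (hGW : G ≤ WIJ n m (2 * n - m)) (hd : finrank ℂ G < m)
    (L₀ : Submodule ℂ (Wsp n)) (hL₀ : finrank ℂ L₀ = m) :
    ∃ L, G ≤ L ∧ IsIsotropic n L ∧ L ≤ WIJ n m (2 * n - m) ∧ finrank ℂ L = m ∧ L ≠ L₀ := by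
  by_cases hGL₀ : G ≤ L₀
  · have h1 := finrank_WIJ (n := n) m (2 * n - m) (by omega) (by omega)
    have h2 := finrank_le_finrank_inf_sperp_add (WIJ n m (2 * n - m)) G
    have hne : ¬ (WIJ n m (2 * n - m) ⊓ sperp n G ≤ L₀) := fun hle => by
      have := Submodule.finrank_mono hle
      omega
    obtain ⟨v, ⟨hvW, hvG⟩, hv⟩ := SetLike.not_le_iff_exists.mp hne
    have hf := finrank_sup_span_singleton_of_notMem fun h => hv (hGL₀ h)
    obtain ⟨L, hL, h3, h4, h5⟩ := exists_lagrangian hm (m - (finrank ℂ G + 1))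
      (G := G ⊔ Submodule.span ℂ {v})
      (hG.sup (isIsotropic_span_singleton v) (le_sperp_comm.mp (by
        rwa [Submodule.span_singleton_le_iff_mem])))
      (sup_le hGW (by rwa [Submodule.span_singleton_le_iff_mem]))
      (by rw [hf]; omega)
    refine ⟨L, le_sup_left.trans hL, h3, h4, h5, ?_⟩
    rintro rfl
    exact hv (hL (le_sup_right (a := G) (Submodule.mem_span_singleton_self v)))
  · obtain ⟨L, hL, h3, h4, h5⟩ := exists_lagrangian hm (m - finrank ℂ G) hG hGW (by omega)
    exact ⟨L, hL, h3, h4, h5, fun h => hGL₀ (h ▸ hL)⟩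

end SymplecticForm

section Columns

open Module

variable {n i : ℕ}

theorem sform_wvec_eq_zero {k p : ℕ} (h : k + p + 1 = 2 * n) {x : Wsp n}
    (hx : sform n x (wvec n (p + 1)) = 0) : x ⟨k, by omega⟩ = 0 := by
  unfold sform at hx
  rw [Finset.sum_eq_single ⟨k, by omega⟩] at hx
  · have hp : 2 * n - 1 - k + 1 = p + 1 := by omega
    simp only [wvec, hp, if_true, mul_one] at hx
    rcases mul_eq_zero.mp hx with h0 | h0
    · split_ifs at h0 <;> simp at h0
    · exact h0
  · intro t _ ht
    have : ¬ 2 * n - 1 - (t : ℕ) + 1 = p + 1 := fun h' =>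
      ht (Fin.ext (by have := t.isLt; simp only []; omega))
    simp only [wvec, if_neg this, mul_zero]
  · simp

/-- The part of row `i - 1` lying in columns `n, …, 2n - i` of a point of `SpR`. -/
structure IsBoundaryRow (n i : ℕ) (R : ℕ → Submodule ℂ (Wsp n)) : Prop where
  dim : ∀ l, n ≤ l → i + l ≤ 2 * n → finrank ℂ (R l) + 1 = i
  sub : ∀ l, n ≤ l → i + l ≤ 2 * n → R l ≤ WIJ n (i - 1) l
  proj : ∀ l, n ≤ l → i + (l + 1) ≤ 2 * n → (R l).map (prj n (l + 1)) ≤ R (l + 1)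
  orth : ∀ l l', n ≤ l → i + l ≤ 2 * n → n ≤ l' → i + l' ≤ 2 * n → R l ≤ sperp n (R l')

/-- A candidate for the part of column `l` in rows `≥ i` of a point of `SpR` whose row `i - 1`
is `R`. -/
structure IsColumn (n i l : ℕ) (R C : ℕ → Submodule ℂ (Wsp n)) : Prop where
  dim : ∀ k, i ≤ k → k + l ≤ 2 * n → finrank ℂ (C k) = k
  sub : ∀ k, i ≤ k → k + l ≤ 2 * n → C k ≤ WIJ n k l
  mono : ∀ k, i ≤ k → k + 1 + l ≤ 2 * n → C k ≤ C (k + 1)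
  bot : R l ≤ C i
  isot : ∀ k, i ≤ k → k + l ≤ 2 * n → IsIsotropic n (C k)
  orth : ∀ k, i ≤ k → k + l ≤ 2 * n → C k ≤ sperp n (R (2 * n - k))

variable {R C : ℕ → Submodule ℂ (Wsp n)}

/-- The spaces `W_{k,l} ∩ R_{2n-k}^⊥` have codimension at most one in their successors. -/
theorem IsBoundaryRow.finrank_le_finrank_inf_add_one (hR : IsBoundaryRow n i R) {k l : ℕ}
    (hk : i ≤ k) (hl : n ≤ l) (hkl : k + 1 + l ≤ 2 * n) {X : Submodule ℂ (Wsp n)}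
    (hX : X ≤ WIJ n (k + 1) l ⊓ sperp n (R (2 * n - (k + 1)))) :
    finrank ℂ X ≤
      finrank ℂ (X ⊓ (WIJ n k l ⊓ sperp n (R (2 * n - k))) : Submodule ℂ (Wsp n)) + 1 := by
  obtain ⟨p, hp⟩ : ∃ p, k + p + 1 = 2 * n := ⟨2 * n - (k + 1), by omega⟩
  rw [show 2 * n - (k + 1) = p by omega] at hX
  rw [show 2 * n - k = p + 1 by omega]
  have hW : ∀ x ∈ WIJ n (k + 1) l, x ⟨k, by omega⟩ = 0 → x ∈ WIJ n k l := by
    intro x hx hxk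
    refine mem_WIJ.mpr fun t h1 h2 => ?_
    rcases h1.eq_or_lt with h | h
    · rwa [show t = ⟨k, by omega⟩ from Fin.ext h.symm]
    · exact mem_WIJ.mp hx t h h2
  have hpr : ∀ x ∈ sperp n (R p), x ⟨k, by omega⟩ = 0 →
      x ∈ sperp n ((R p).map (prj n (p + 1))) := by
    rintro x hx hxk _ ⟨u, hu, rfl⟩
    rw [← hx u hu]
    refine sform_eq_sform_of_mul_eq fun s t hst => ?_
    rw [prj_apply]
    split_ifs with ht
    · rw [show s = ⟨k, by omega⟩ from Fin.ext (by simp only []; omega), hxk, zero_mul, zero_mul]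
    · rfl
  obtain ⟨f, hf⟩ : ∃ f : Wsp n →ₗ[ℂ] ℂ, ∀ x ∈ WIJ n (k + 1) l ⊓ sperp n (R p), f x = 0 →
      x ∈ WIJ n k l ⊓ sperp n (R (p + 1)) := by
    by_cases hmap : (R p).map (prj n (p + 1)) = R (p + 1)
    · refine ⟨LinearMap.proj (R := ℂ) (φ := fun _ => ℂ) ⟨k, by omega⟩, fun x hx hxk => ?_⟩
      replace hxk : x ⟨k, by omega⟩ = 0 := hxk
      refine ⟨hW x hx.1 hxk, ?_⟩
      rw [← hmap]
      exact hpr x hx.2 hxk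
    · have hle := hR.proj p (by omega) (by omega)
      have hlt := Submodule.finrank_lt_finrank_of_lt (lt_of_le_of_ne hle hmap)
      have hdim := finrank_map_add_finrank_inf_ker (prj n (p + 1)) (R p)
      have hd := hR.dim p (by omega) (by omega)
      have hd' := hR.dim (p + 1) (by omega) (by omega)
      have hw : wvec n (p + 1) ∈ R p := by
        obtain ⟨v, hv, hv0⟩ := Submodule.exists_mem_ne_zero_of_ne_bot
          (p := R p ⊓ LinearMap.ker (prj n (p + 1))) (fun h => by
            rw [h, finrank_bot] at hdim
            omega)
        obtain ⟨c, rfl⟩ := Submodule.mem_span_singleton.mp (ker_prj_le _ hv.2)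
        exact (Submodule.smul_mem_iff _ (fun hc => hv0 (by rw [hc, zero_smul]))).mp hv.1
      obtain ⟨u, hu, hu'⟩ := SetLike.exists_of_lt (lt_of_le_of_ne hle hmap)
      have hsup : (R p).map (prj n (p + 1)) ⊔ Submodule.span ℂ {u} = R (p + 1) := by
        refine Submodule.eq_of_le_of_finrank_le
          (sup_le hle (by rwa [Submodule.span_singleton_le_iff_mem])) ?_
        rw [finrank_sup_span_singleton_of_notMem hu']
        have := (Submodule.finrank_mono
          (inf_le_right (a := R p) (b := LinearMap.ker (prj n (p + 1))))).trans
          (finrank_ker_prj_le (p + 1))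
        omega
      refine ⟨(sformB n).flip u, fun x hx hxu => ?_⟩
      have hxk : x ⟨k, by omega⟩ = 0 := sform_wvec_eq_zero hp (hx.2 _ hw)
      refine ⟨hW x hx.1 hxk, fun y hy => ?_⟩
      rw [← hsup] at hy
      obtain ⟨a, ha, b, hb, rfl⟩ := Submodule.mem_sup.mp hy
      obtain ⟨c, rfl⟩ := Submodule.mem_span_singleton.mp hb
      rw [sform_add_right, sform_smul_right, hpr x hx.2 hxk a ha, show sform n x u = 0 from hxu,
        mul_zero, add_zero]
  have h1 := finrank_le_finrank_inf_ker_add f X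
  rw [finrank_self] at h1
  have h2 : X ⊓ LinearMap.ker f ≤ X ⊓ (WIJ n k l ⊓ sperp n (R (p + 1))) :=
    fun x hx => ⟨hx.1, hf x (hX hx.1) hx.2⟩
  have := Submodule.finrank_mono h2
  omega

theorem IsColumn.row_le {l : ℕ} (hC : IsColumn n i l R C) {k : ℕ} (hk : i ≤ k)
    (hkl : k + l ≤ 2 * n) : R l ≤ C k := by
  induction k, hk using Nat.le_induction with
  | base => exact hC.bot
  | succ k hk ih => exact (ih (by omega)).trans (hC.mono k hk (by omega))

theorem IsColumn.map_prj_sup_le {l : ℕ} (hC : IsColumn n i l R C) (hR : IsBoundaryRow n i R)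
    (hl : n ≤ l) {k : ℕ} (hk : i ≤ k) (hkl : k + (l + 1) ≤ 2 * n) :
    (C k).map (prj n (l + 1)) ⊔ R (l + 1) ≤
      WIJ n k (l + 1) ⊓ sperp n (R (2 * n - k)) := by
  refine sup_le (le_inf ?_ ?_) (le_inf ?_ (hR.orth _ _ ?_ ?_ ?_ ?_))
  · rintro _ ⟨x, hx, rfl⟩
    exact prj_mem_WIJ (hC.sub k hk (by omega) hx)
  · rintro _ ⟨x, hx, rfl⟩ u hu
    rw [← hC.orth k hk (by omega) hx u hu]
    refine sform_eq_sform_of_mul_eq fun s t hst => ?_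
    rw [prj_apply]
    split_ifs with hs
    · rw [mem_WIJ.mp (hR.sub _ (by omega) (by omega) hu) t (by omega) (by omega)]
      simp
    · rfl
  · exact (hR.sub _ (by omega) (by omega)).trans (WIJ_mono (by omega) le_rfl)
  all_goals omega

theorem IsColumn.finrank_map_prj_sup_le {l : ℕ} (hC : IsColumn n i l R C)
    (hR : IsBoundaryRow n i R) (hl : n ≤ l) {k : ℕ} (hk : i ≤ k) (hkl : k + (l + 1) ≤ 2 * n) :
    finrank ℂ ((C k).map (prj n (l + 1)) ⊔ R (l + 1) : Submodule ℂ (Wsp n)) ≤ k := by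
  have h1 := hR.dim l hl (by omega)
  have h2 := hR.dim (l + 1) (by omega) (by omega)
  have := finrank_map_sup_le (prj n (l + 1)) (hC.row_le hk (by omega))
    (hR.proj l hl (by omega)) (by omega)
  rwa [hC.dim k hk (by omega)] at this

theorem IsColumn.isIsotropic_map_prj_sup {l m : ℕ} (hC : IsColumn n i l R C)
    (hR : IsBoundaryRow n i R) (hl : n ≤ l) (hm : i ≤ m) (hml : m + (l + 1) = 2 * n) :
    IsIsotropic n ((C m).map (prj n (l + 1)) ⊔ R (l + 1)) := by
  have h := hC.map_prj_sup_le hR hl hm (by omega)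
  rw [show 2 * n - m = l + 1 by omega] at h
  exact ((hC.isot m hm (by omega)).map_prj (hC.sub m hm (by omega)) hl (by omega)).sup
    (hR.orth _ _ (by omega) (by omega) (by omega) (by omega))
    (le_sup_left.trans (h.trans inf_le_right))

theorem IsColumn.exists_next_column_of_top {l m : ℕ} (hC : IsColumn n i l R C) (hR : IsBoundaryRow n i R)
    (hl : n ≤ l) (hm : i ≤ m) (hml : m + (l + 1) = 2 * n) {L : Submodule ℂ (Wsp n)}
    (hGL : (C m).map (prj n (l + 1)) ⊔ R (l + 1) ≤ L) (hLi : IsIsotropic n L)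
    (hLW : L ≤ WIJ n m (l + 1)) (hL : finrank ℂ L = m) :
    ∃ C', IsColumn n i (l + 1) R C' ∧
      (∀ k, i ≤ k → k + (l + 1) ≤ 2 * n → (C k).map (prj n (l + 1)) ≤ C' k) ∧ C' m = L := by
  have hml' : 2 * n - m = l + 1 := by omega
  obtain ⟨C', hm', h, hmono⟩ := exists_flag
    (fun k => (C k).map (prj n (l + 1)) ⊔ R (l + 1))
    (fun k => WIJ n k (l + 1) ⊓ sperp n (R (2 * n - k))) i m hm
    (fun k hk hkm => hC.map_prj_sup_le hR hl hk (by omega))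
    (fun k hk hkm => hC.finrank_map_prj_sup_le hR hl hk (by omega))
    (fun k hk hkm => sup_le_sup_right (Submodule.map_mono (hC.mono k hk (by omega))) _)
    (fun k hk hkm X hX => hR.finrank_le_finrank_inf_add_one hk (by omega) (by omega) hX)
    L hGL (le_inf hLW (by
      rw [hml']
      exact le_trans hLi (sperp_anti (le_sup_right.trans hGL)))) hL
  have hle : ∀ k, i ≤ k → k ≤ m → C' k ≤ L := by
    intro k hk hkm
    refine Nat.decreasingInduction' (P := fun k => C' k ≤ L) (fun k h1 h2 ih => ?_) hkm hm'.le
    exact (hmono k (by omega) h1).trans ih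
  refine ⟨C', ⟨fun k hk hkl => (h k hk (by omega)).2.2,
    fun k hk hkl => (h k hk (by omega)).2.1.trans inf_le_left,
    fun k hk hkl => hmono k hk (by omega), le_sup_right.trans (h i le_rfl hm).1,
    fun k hk hkl => hLi.mono (hle k hk (by omega)),
    fun k hk hkl => (h k hk (by omega)).2.1.trans inf_le_right⟩,
    fun k hk hkl => le_sup_left.trans (h k hk (by omega)).1, hm'⟩

theorem IsColumn.exists_next_column {l : ℕ} (hC : IsColumn n i l R C) (hR : IsBoundaryRow n i R)
    (hl : n ≤ l) (hil : i + (l + 1) ≤ 2 * n) :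
    ∃ C', IsColumn n i (l + 1) R C' ∧
      ∀ k, i ≤ k → k + (l + 1) ≤ 2 * n → (C k).map (prj n (l + 1)) ≤ C' k := by
  obtain ⟨m, hml⟩ : ∃ m, m + (l + 1) = 2 * n := ⟨2 * n - (l + 1), by omega⟩
  have hW := (hC.map_prj_sup_le hR hl (k := m) (by omega) (by omega)).trans inf_le_left
  have hd := hC.finrank_map_prj_sup_le hR hl (k := m) (by omega) (by omega)
  have hml' : l + 1 = 2 * n - m := by omega
  replace hW := hW.trans (WIJ_mono le_rfl hml'.ge)
  obtain ⟨L, h1, h2, h3, h4⟩ := exists_lagrangian (by omega) (m - _)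
    (hC.isIsotropic_map_prj_sup hR hl (by omega) hml) hW (Nat.add_sub_cancel' hd)
  rw [← hml'] at h3
  obtain ⟨C', hC', hproj, -⟩ := hC.exists_next_column_of_top hR hl (by omega) hml h1 h2 h3 h4
  exact ⟨C', hC', hproj⟩

end Columns

section Points

open Module

variable {n : ℕ} {V : ℕ → ℕ → Submodule ℂ (Wsp n)}

theorem IsSpR.le_of_le (hV : IsSpR n V) {k k' l : ℕ} (hk : 1 ≤ k) (hkk' : k ≤ k') (hl : k' ≤ l)
    (hkl : k' + l ≤ 2 * n) : V k l ≤ V k' l := by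
  induction k', hkk' using Nat.le_induction with
  | base => exact le_rfl
  | succ k' hkk' ih =>
    exact (ih (by omega) (by omega)).trans (hV.mono k' l (by omega) (by omega) (by omega))

theorem IsSpR.exists_mem_agree (hV : IsSpR n V) {k : ℕ} (hk : 1 ≤ k) (d : ℕ) {l : ℕ}
    (hkl : k ≤ l) (hd : k + l + d = 2 * n) {x : Wsp n} (hx : x ∈ V k l) :
    ∃ y ∈ V k (2 * n - k), ∀ t : Fin (2 * n), (t : ℕ) < l ∨ 2 * n - k ≤ t → y t = x t := by
  induction d generalizing l x with
  | zero =>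
    obtain rfl : l = 2 * n - k := by omega
    exact ⟨x, hx, fun _ _ => rfl⟩
  | succ d ih =>
    obtain ⟨y, hy, h⟩ := ih (l := l + 1) (by omega) (by omega)
      (hV.proj k l hk hkl (by omega) ⟨x, hx, rfl⟩)
    refine ⟨y, hy, fun t ht => ?_⟩
    rw [h t (by omega), prj_apply, if_neg (by omega)]

theorem IsSpR.le_sperp (hV : IsSpR n V) {k l l' : ℕ} (hk : 1 ≤ k) (hl : n ≤ l)
    (hkl : k + l ≤ 2 * n) (hl' : n ≤ l') (hkl' : k + l' ≤ 2 * n) :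
    V k l ≤ sperp n (V k l') := by
  intro x hx x' hx'
  obtain ⟨y, hy, h⟩ := hV.exists_mem_agree hk (2 * n - (k + l)) (by omega) (by omega) hx
  obtain ⟨y', hy', h'⟩ := hV.exists_mem_agree hk (2 * n - (k + l')) (by omega) (by omega) hx'
  rw [← hV.isot k hk (by omega) y hy y' hy']
  have hW := mem_WIJ.mp (hV.sub k l hk (by omega) hkl hx)
  have hW' := mem_WIJ.mp (hV.sub k l' hk (by omega) hkl' hx')
  have hY := mem_WIJ.mp (hV.sub k (2 * n - k) hk (by omega) (by omega) hy)
  have hY' := mem_WIJ.mp (hV.sub k (2 * n - k) hk (by omega) (by omega) hy')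
  refine sform_eq_sform_of_mul_eq fun s t hst => ?_
  by_cases hs : l ≤ (s : ℕ) ∧ (s : ℕ) < 2 * n - k
  · rw [hW' t (by omega) (by omega), hY' t (by omega) (by omega), mul_zero, mul_zero]
  · by_cases ht : l' ≤ (t : ℕ) ∧ (t : ℕ) < 2 * n - k
    · rw [hW s (by omega) (by omega), hY s (by omega) (by omega), zero_mul, zero_mul]
    · rw [h s (by omega), h' t (by omega)]

theorem IsSpR.isBoundaryRow (hV : IsSpR n V) {i : ℕ} (hi : 1 ≤ i) :
    IsBoundaryRow n i (fun l => if i = 1 then ⊥ else V (i - 1) l) := by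
  rcases eq_or_ne i 1 with rfl | h
  · constructor <;> simp
  · have hrow : (fun l => if i = 1 then ⊥ else V (i - 1) l) = V (i - 1) :=
      funext fun _ => if_neg h
    rw [hrow]
    constructor
    · intro l h1 h2
      rw [hV.dim (i - 1) l (by omega) (by omega) (by omega)]
      omega
    · exact fun l h1 h2 => hV.sub (i - 1) l (by omega) (by omega) (by omega)
    · exact fun l h1 h2 => hV.proj (i - 1) l (by omega) (by omega) (by omega)
    · exact fun l l' h1 h2 h3 h4 =>
        hV.le_sperp (by omega) (by omega) (by omega) (by omega) (by omega)

theorem IsSpR.row_le (hV : IsSpR n V) {i k l : ℕ} (hi : 1 ≤ i) (hik : i ≤ k) (hkl : k ≤ l)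
    (hsum : k + l ≤ 2 * n) : (if i = 1 then ⊥ else V (i - 1) l) ≤ V k l := by
  split_ifs with h
  · exact bot_le
  · exact hV.le_of_le (by omega) (by omega) hkl hsum

theorem IsSpR.isColumn (hV : IsSpR n V) {i l : ℕ} (hi : 1 ≤ i) (hl : n ≤ l)
    (hil : i + l ≤ 2 * n) :
    IsColumn n i l (fun l => if i = 1 then ⊥ else V (i - 1) l) (fun k => V k l) where
  dim k hk hkl := hV.dim k l (by omega) (by omega) hkl
  sub k hk hkl := hV.sub k l (by omega) (by omega) hkl
  mono k hk hkl := hV.mono k l (by omega) (by omega) hkl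
  bot := hV.row_le hi le_rfl (by omega) hil
  isot k hk hkl := hV.le_sperp (by omega) hl hkl hl hkl
  orth k hk hkl := (hV.le_sperp (by omega) hl hkl (by omega) (by omega)).trans
    (sperp_anti (hV.row_le hi hk (by omega) (by omega)))

end Points

theorem statement11 (n i j : ℕ) (hn : 1 ≤ n) (hi : 1 ≤ i) (hij : i ≤ j)
    (hjn : n ≤ j) (hsum : i + j < 2*n)
    (V : ℕ → ℕ → Submodule ℂ (Wsp n)) (hV : IsSpR n V) (hZ : InZ n V i j) :
    ∃ V' : ℕ → ℕ → Submodule ℂ (Wsp n),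
      IsSpR n V' ∧ InZ n V' i j ∧
      (∀ k, 1 ≤ k → k ≤ n → V' k k = V k k) ∧
      (∃ k l, 1 ≤ k ∧ k ≤ l ∧ k + l ≤ 2*n ∧ V' k l ≠ V k l) := by
  obtain ⟨m, hm⟩ : ∃ m, m + (j + 1) = 2 * n := ⟨2 * n - (j + 1), by omega⟩
  have hm' : 2 * n - m = j + 1 := by omega
  set R : ℕ → Submodule ℂ (Wsp n) := fun l => if i = 1 then ⊥ else V (i - 1) l with hRdef
  have hR : IsBoundaryRow n i R := hV.isBoundaryRow hi
  have hC : IsColumn n i j R (fun k => V k j) := hV.isColumn hi hjn (by omega)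
  have hVij : V i j = R (j + 1) ⊔ Submodule.span ℂ {wvec n (j + 1)} := hZ
  have hiV : V i j ≤ V m j := hV.le_of_le hi (by omega) (by omega) (by omega)
  -- The lower bound for the `(m, j + 1)` entry has dimension less than `m`.
  have hlt : Module.finrank ℂ
      ((V m j).map (prj n (j + 1)) ⊔ R (j + 1) : Submodule ℂ (Wsp n)) < m := by
    have hRle : R (j + 1) ≤ (V m j).map (prj n (j + 1)) := fun x hx =>
      ⟨x, hiV (hVij ▸ Submodule.mem_sup_left hx),
        prj_eq_self (hR.sub (j + 1) (by omega) (by omega) hx) (by omega) le_rfl⟩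
    rw [sup_eq_left.mpr hRle]
    have hdim := finrank_map_add_finrank_inf_ker (prj n (j + 1)) (V m j)
    have hw : Submodule.span ℂ {wvec n (j + 1)} ≤ V m j ⊓ LinearMap.ker (prj n (j + 1)) := by
      rw [Submodule.span_singleton_le_iff_mem]
      exact ⟨hiV (hVij ▸ Submodule.mem_sup_right (Submodule.mem_span_singleton_self _)),
        prj_wvec _⟩
    have hw0 : wvec n (j + 1) ≠ 0 := fun h => by
      have := congrFun h ⟨j, by omega⟩
      simp [wvec] at this
    have := Submodule.finrank_mono hw
    rw [finrank_span_singleton hw0] at this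
    rw [hV.dim m j (by omega) (by omega) (by omega)] at hdim
    omega
  obtain ⟨L, hGL, hLi, hLW, hLd, hLne⟩ := exists_lagrangian_ne (by omega)
    (hC.isIsotropic_map_prj_sup hR hjn (by omega) hm)
    (((hC.map_prj_sup_le hR hjn (k := m) (by omega) (by omega)).trans inf_le_left).trans
      (WIJ_mono le_rfl hm'.le)) hlt (V m (j + 1))
    (hV.dim m (j + 1) (by omega) (by omega) (by omega))
  rw [hm'] at hLW
  obtain ⟨C, hC₁, hCproj, hCm⟩ := hC.exists_next_column_of_top hR hjn (by omega) hm hGL hLi hLW hLd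
  obtain ⟨s, hs0, hs⟩ := exists_seq_of_step
    (P := fun d C => i + (j + 1 + d) ≤ 2 * n → IsColumn n i (j + 1 + d) R C)
    (r := fun d C C' => i + (j + 1 + d + 1) ≤ 2 * n → ∀ k, i ≤ k → k + (j + 1 + d + 1) ≤ 2 * n →
      (C k).map (prj n (j + 1 + d + 1)) ≤ C' k) C (fun _ => hC₁) (fun d C hCd => by
        by_cases h : i + (j + 1 + d + 1) ≤ 2 * n
        · obtain ⟨C', h1, h2⟩ := (hCd (by omega)).exists_next_column hR (by omega) h
          exact ⟨C', fun _ => h1, fun _ => h2⟩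
        · exact ⟨C, fun h' => absurd h' h, fun h' => absurd h' h⟩)
  have hD : ∀ l, j + 1 ≤ l → i + l ≤ 2 * n → IsColumn n i l R (s (l - (j + 1))) := by
    intro l h1 h2
    obtain ⟨d, rfl⟩ := Nat.exists_eq_add_of_le h1
    rw [Nat.add_sub_cancel_left]
    exact (hs d).1 h2
  have hDproj : ∀ k l, j + 1 ≤ l → i ≤ k → k + (l + 1) ≤ 2 * n →
      (s (l - (j + 1)) k).map (prj n (l + 1)) ≤ s (l + 1 - (j + 1)) k := by
    intro k l h1 h2 h3
    obtain ⟨d, rfl⟩ := Nat.exists_eq_add_of_le h1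
    rw [Nat.add_sub_cancel_left, show j + 1 + d + 1 - (j + 1) = d + 1 by omega]
    exact (hs d).2 (by omega) k h2 h3
  set V' : ℕ → ℕ → Submodule ℂ (Wsp n) :=
    fun k l => if i ≤ k ∧ j + 1 ≤ l then s (l - (j + 1)) k else V k l with hV'def
  have hin : ∀ {k l}, i ≤ k → j + 1 ≤ l → V' k l = s (l - (j + 1)) k :=
    fun h1 h2 => if_pos ⟨h1, h2⟩
  have hout : ∀ {k l}, ¬ (i ≤ k ∧ j + 1 ≤ l) → V' k l = V k l := fun h => if_neg h
  refine ⟨V', ⟨fun k l hk hkl hle => ?_, fun k l hk hkl hle => ?_, fun k l hk hkl hle => ?_,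
    fun k l hk hkl hle => ?_, fun k hk hkn => ?_⟩, ?_, fun k hk hkn => hout (by omega),
    m, j + 1, by omega, by omega, by omega, ?_⟩
  · by_cases h : i ≤ k ∧ j + 1 ≤ l
    · rw [hin h.1 h.2]
      exact (hD l h.2 (by omega)).dim k h.1 hle
    · rw [hout h]
      exact hV.dim k l hk hkl hle
  · by_cases h : i ≤ k ∧ j + 1 ≤ l
    · rw [hin h.1 h.2]
      exact (hD l h.2 (by omega)).sub k h.1 hle
    · rw [hout h]
      exact hV.sub k l hk hkl hle
  · by_cases h : i ≤ k ∧ j + 1 ≤ l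
    · rw [hin h.1 h.2, hin (by omega) h.2]
      exact (hD l h.2 (by omega)).mono k h.1 hle
    · rw [hout h]
      by_cases h' : i ≤ k + 1 ∧ j + 1 ≤ l
      · obtain rfl : i = k + 1 := by omega
        rw [hin le_rfl h'.2]
        have := (hD l h'.2 hle).bot
        simpa only [hRdef, if_neg (show k + 1 ≠ 1 by omega), Nat.add_sub_cancel] using this
      · rw [hout h']
        exact hV.mono k l hk hkl hle
  · by_cases h : i ≤ k ∧ j + 1 ≤ l
    · rw [hin h.1 h.2, hin h.1 (by omega)]
      exact hDproj k l h.2 h.1 hle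
    · rw [hout h]
      by_cases h' : i ≤ k ∧ j + 1 ≤ l + 1
      · obtain rfl : l = j := by omega
        rw [hin h'.1 le_rfl, Nat.sub_self, hs0]
        exact hCproj k h'.1 hle
      · rw [hout h']
        exact hV.proj k l hk hkl hle
  · by_cases h : i ≤ k ∧ j + 1 ≤ 2 * n - k
    · rw [hin h.1 h.2]
      exact (hD _ h.2 (by omega)).isot k h.1 (by omega)
    · rw [hout h]
      exact hV.isot k hk hkn
  · unfold InZ
    rw [hout (by omega), hout (by omega)]
    exact hZ
  · rw [hin (by omega) le_rfl, Nat.sub_self, hs0, hCm]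
    exact hLne
end
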